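/- arXiv:1408.4068 — 2 statements merged into one kernel-verified Lean document; each statement's English description precedes it below -/
import Mathlib

section
/- Let g ≥ 3. The centrally extended Wajnryb group G_{g,1} is a perfect group, i.e. it equals its own commutator subgroup. -/
/-!  The centrally extended Wajnryb presentations (Nosaka, Theorem 1).

Generators: `c₀, c₁, …, c_{2g+1}` (indexed by `Fin (2*g+2)`, as Dehn twists along the Wajnryb
curves `γ₀, …, γ_{2g+1}`) together with a central generator `μ` (the extra `Unit` summand).
`I i j = 1` iff `{i,j} = {0,4}` or `i, j ≥ 1` with `|i - j| = 1`, and `I i j = 0` otherwise. -/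

namespace Wajnryb

/-- The generators: `Sum.inl i` is `c_i` and `Sum.inr ()` is `μ`. -/
abbrev Gen (g : ℕ) := Sum (Fin (2*g+2)) Unit

/-- The generator `c_n` as an element of the free group (for `n ≤ 2g+1` this is the `n`-th
Wajnryb generator; indices are taken mod `2g+2`). -/
def c (g n : ℕ) : FreeGroup (Gen g) :=
  FreeGroup.of (Sum.inl ⟨n % (2*g+2), Nat.mod_lt n (by omega)⟩)

/-- The central generator `μ`. -/
def mu (g : ℕ) : FreeGroup (Gen g) := FreeGroup.of (Sum.inr ())

/-- `Iw i j` holds iff the geometric intersection number `I(γ_i, γ_j)` equals `1`: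
the curves `γ₁, …, γ_{2g+1}` form a chain and `γ₀` meets only `γ₄`, once. -/
def Iw (i j : ℕ) : Prop :=
  (i = 0 ∧ j = 4) ∨ (i = 4 ∧ j = 0) ∨ (1 ≤ i ∧ 1 ≤ j ∧ (i = j + 1 ∨ j = i + 1))

/-- The word `b₀`. -/
def b0 (g : ℕ) : FreeGroup (Gen g) :=
  (c g 4 * c g 3 * c g 2 * c g 1 * c g 1 * c g 2 * c g 3 * c g 4)⁻¹ * c g 0 *
    (c g 4 * c g 3 * c g 2 * c g 1 * c g 1 * c g 2 * c g 3 * c g 4)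

/-- The word `b₁`. -/
def b1 (g : ℕ) : FreeGroup (Gen g) :=
  (c g 4 * c g 5 * c g 3 * c g 4)⁻¹ * c g 0 * (c g 4 * c g 5 * c g 3 * c g 4)

/-- The word `b₂`. -/
def b2 (g : ℕ) : FreeGroup (Gen g) :=
  (c g 2 * c g 3 * c g 1 * c g 2)⁻¹ * b1 g * (c g 2 * c g 3 * c g 1 * c g 2)

/-- The conjugating word appearing in `b₃`. -/
def w3 (g : ℕ) : FreeGroup (Gen g) :=
  c g 6 * c g 5 * c g 4 * c g 3 * c g 2 * (c g 5)⁻¹ * (c g 6)⁻¹ * b1 g * c g 6 * c g 5 *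
    (c g 1)⁻¹ * (c g 2)⁻¹ * (c g 3)⁻¹ * (c g 4)⁻¹

/-- The word `b₃`. -/
def b3 (g : ℕ) : FreeGroup (Gen g) := (w3 g)⁻¹ * c g 0 * w3 g

/-- The relators of the centrally extended Wajnryb group `G_{g,1}`:
braid relations, the 3-chain relation `(c₁c₂c₃)⁴(c₀b₀)⁻¹ = μ` with `μ` central, and the
lantern relation `c₀b₂b₁(c₁c₃c₅b₃)⁻¹ = 1`. -/
def rels1 (g : ℕ) : Set (FreeGroup (Gen g)) :=
  {r | ∃ i j : Fin (2*g+2), ¬ Iw i.val j.val ∧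
      r = c g i.val * c g j.val * (c g j.val * c g i.val)⁻¹} ∪
  {r | ∃ i j : Fin (2*g+2), Iw i.val j.val ∧
      r = c g i.val * c g j.val * c g i.val * (c g j.val * c g i.val * c g j.val)⁻¹} ∪
  {(c g 1 * c g 2 * c g 3) ^ 4 * (c g 0 * b0 g)⁻¹ * (mu g)⁻¹} ∪
  {r | ∃ i : Fin (2*g+2), r = c g i.val * mu g * (mu g * c g i.val)⁻¹} ∪
  {c g 0 * b2 g * b1 g * (c g 1 * c g 3 * c g 5 * b3 g)⁻¹}

/-- The word `c_{2g} c_{2g-1} ⋯ c₁ c₁ c₂ ⋯ c_{2g}` of the closed-surface relation. -/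
def dword (g : ℕ) : FreeGroup (Gen g) :=
  (((List.range' 1 (2*g)).reverse.map (c g)).prod) * (((List.range' 1 (2*g)).map (c g)).prod)

/-- The relators of the closed-surface centrally extended Wajnryb group `G_{g,0}`: those of
`G_{g,1}` together with the relation that `c_{2g}⋯c₁c₁⋯c_{2g}` commutes with `c_{2g+1}`. -/
def rels0 (g : ℕ) : Set (FreeGroup (Gen g)) :=
  rels1 g ∪ {dword g * c g (2*g+1) * (c g (2*g+1) * dword g)⁻¹}

/-- The centrally extended Wajnryb group `G_{g,1}`. -/
abbrev Gg1 (g : ℕ) := PresentedGroup (rels1 g)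

/-- The closed-surface centrally extended Wajnryb group `G_{g,0}`. -/
abbrev Gg0 (g : ℕ) := PresentedGroup (rels0 g)

/-- The central element `μ ∈ G_{g,1}`. -/
def mu1 (g : ℕ) : Gg1 g := PresentedGroup.mk (rels1 g) (mu g)

/-- The central element `μ ∈ G_{g,0}`. -/
def mu0 (g : ℕ) : Gg0 g := PresentedGroup.mk (rels0 g) (mu g)

end Wajnryb

namespace Wajnryb

/-- A homomorphism to a commutative group is invariant under conjugation. -/
theorem map_conj_inv {G A : Type*} [Group G] [CommGroup A] (f : G →* A) (w x : G) :
    f (w⁻¹ * x * w) = f x := by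
  rw [map_mul, map_mul, map_inv, mul_right_comm, inv_mul_cancel, one_mul]

/-- A homomorphism to a commutative group that kills the braid relators takes the same value on
any two generators whose curves meet once. -/
theorem map_c_eq_of_Iw {g : ℕ} {A : Type*} [CommGroup A] (f : FreeGroup (Gen g) →* A)
    (hf : ∀ r ∈ rels1 g, f r = 1) {i j : ℕ} (hi : i < 2 * g + 2) (hj : j < 2 * g + 2)
    (hij : Iw i j) : f (c g i) = f (c g j) := by
  have h := hf (c g i * c g j * c g i * (c g j * c g i * c g j)⁻¹)
    (Or.inl (Or.inl (Or.inl (Or.inr ⟨⟨i, hi⟩, ⟨j, hj⟩, hij, rfl⟩))))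
  rw [map_mul, map_inv, mul_inv_eq_one] at h
  simp only [map_mul] at h
  rw [mul_comm (f (c g j)) (f (c g i))] at h
  exact mul_left_cancel h

/-- If `g ≥ 2`, a homomorphism to a commutative group that kills the relators of `G_{g,1}` takes
the same value on all the generators `c_i`. -/
theorem map_c_eq {g : ℕ} (hg : 2 ≤ g) {A : Type*} [CommGroup A] (f : FreeGroup (Gen g) →* A)
    (hf : ∀ r ∈ rels1 g, f r = 1) {n : ℕ} (hn : n < 2 * g + 2) : f (c g n) = f (c g 1) := by
  have chain : ∀ m, m + 1 < 2 * g + 2 → f (c g (m + 1)) = f (c g 1) := by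
    intro m
    induction m with
    | zero => intro _; rfl
    | succ m ih =>
      intro hm
      rw [← ih (by omega)]
      exact map_c_eq_of_Iw f hf hm (by omega) (by unfold Iw; omega)
  cases n with
  | zero =>
    rw [← chain 3 (by omega)]
    exact map_c_eq_of_Iw f hf hn (by omega) (Or.inl ⟨rfl, rfl⟩)
  | succ m => exact chain m hn

/-- If `g ≥ 3`, every homomorphism to a commutative group that kills the relators of `G_{g,1}`
is trivial. -/
theorem eq_one_of_map_rels1 {g : ℕ} (hg : 3 ≤ g) {A : Type*} [CommGroup A]
    (f : FreeGroup (Gen g) →* A) (hf : ∀ r ∈ rels1 g, f r = 1) : f = 1 := by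
  have hc {n : ℕ} (hn : n < 2 * g + 2) : f (c g n) = f (c g 1) :=
    map_c_eq (by omega) f hf hn
  have h0 := hc (n := 0) (by omega)
  have hb0 : f (b0 g) = f (c g 1) := (map_conj_inv f _ _).trans h0
  have hb1 : f (b1 g) = f (c g 1) := (map_conj_inv f _ _).trans h0
  have hb2 : f (b2 g) = f (c g 1) := (map_conj_inv f _ _).trans hb1
  have hb3 : f (b3 g) = f (c g 1) := (map_conj_inv f _ _).trans h0
  have h1 : f (c g 1) = 1 := by
    have lantern := hf _ (Or.inr rfl)
    rw [map_mul, map_inv, mul_inv_eq_one] at lantern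
    simp only [map_mul, h0, hb1, hb2, hb3, hc (n := 3) (by omega), hc (n := 5) (by omega)]
      at lantern
    exact left_eq_mul.mp lantern
  have hmu : f (mu g) = 1 := by
    have threeChain := hf _ (Or.inl (Or.inl (Or.inr rfl)))
    simpa [h0, hb0, h1, hc (n := 2) (by omega), hc (n := 3) (by omega)] using threeChain
  ext x
  rcases x with ⟨i, hi⟩ | ⟨⟩
  · have hi' := (hc hi).trans h1
    simpa only [c, Nat.mod_eq_of_lt hi, MonoidHom.one_apply] using hi'
  · exact hmu

end Wajnryb

open Wajnryb in
/-- For `g ≥ 3`, the centrally extended Wajnryb group `G_{g,1}` is perfect. -/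
theorem Gg1_perfect (g : ℕ) (hg : 3 ≤ g) : commutator (Gg1 g) = ⊤ := by
  have hf := eq_one_of_map_rels1 hg (Abelianization.of.comp (PresentedGroup.mk (rels1 g)))
    fun r hr => by
      rw [MonoidHom.comp_apply, PresentedGroup.one_of_mem hr, map_one]
  rw [← Abelianization.ker_of, MonoidHom.ker_eq_top_iff]
  exact (MonoidHom.cancel_right (PresentedGroup.mk_surjective (rels1 g))).mp hf
end

section
/- Let g ≥ 3 and r ∈ {0, 1}. The second group cohomology of the centrally extended Wajnryb group G_{g,r} with coefficients in ℤ (with the trivial action) vanishes: H²(G_{g,r}; ℤ) ≅ 0. -/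
/-- The extension of `G` by `ℤ` determined by a 2-cocycle: the set `ℤ × G` with twisted
multiplication. -/
@[ext]
structure CocycleExtension {G : Type} [Group G]
    (f : groupCohomology.cocycles₂ (Rep.trivial ℤ G ℤ)) where
  /-- The coordinate in the kernel. -/
  fiber : ℤ
  /-- The coordinate in the quotient. -/
  base : G

namespace CocycleExtension

variable {G : Type} [Group G] (f : groupCohomology.cocycles₂ (Rep.trivial ℤ G ℤ))

/-- The cocycle as an integer-valued function. -/
def val (a b : G) : ℤ := f (a, b)

theorem val_cocycle (a b c : G) : val f (a * b) c + val f a b = val f b c + val f a (b * c) :=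
  (groupCohomology.mem_cocycles₂_iff (f : G × G → _)).1 f.2 a b c

theorem val_one_left (a : G) : val f 1 a = val f 1 1 := by
  simpa using (val_cocycle f 1 1 a).symm

theorem val_one_right (a : G) : val f a 1 = val f 1 1 := by
  simpa using val_cocycle f a 1 1

instance : Mul (CocycleExtension f) :=
  ⟨fun x y => ⟨x.fiber + y.fiber + val f x.base y.base, x.base * y.base⟩⟩

instance : One (CocycleExtension f) := ⟨⟨-val f 1 1, 1⟩⟩

instance : Inv (CocycleExtension f) :=
  ⟨fun x => ⟨-x.fiber - val f x.base⁻¹ x.base - val f 1 1, x.base⁻¹⟩⟩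

variable {f}

@[simp] theorem mul_fiber (x y : CocycleExtension f) :
    (x * y).fiber = x.fiber + y.fiber + val f x.base y.base := rfl

@[simp] theorem mul_base (x y : CocycleExtension f) : (x * y).base = x.base * y.base := rfl

@[simp] theorem one_fiber : (1 : CocycleExtension f).fiber = -val f 1 1 := rfl

@[simp] theorem one_base : (1 : CocycleExtension f).base = 1 := rfl

@[simp] theorem inv_fiber (x : CocycleExtension f) :
    x⁻¹.fiber = -x.fiber - val f x.base⁻¹ x.base - val f 1 1 := rfl

@[simp] theorem inv_base (x : CocycleExtension f) : x⁻¹.base = x.base⁻¹ := rfl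

instance : Group (CocycleExtension f) :=
  Group.ofLeftAxioms
    (fun x y z => by
      ext
      · have := val_cocycle f x.base y.base z.base
        simp only [mul_fiber, mul_base]
        linarith
      · exact mul_assoc _ _ _)
    (fun x => by ext <;> simp [val_one_left])
    (fun x => by
      ext
      · simp only [mul_fiber, inv_fiber, inv_base, one_fiber]
        ring
      · exact inv_mul_cancel _)

variable (f) in
/-- The projection of the extension onto its quotient. -/
def proj : CocycleExtension f →* G where
  toFun := base
  map_one' := rfl
  map_mul' _ _ := rfl

theorem proj_surjective : Function.Surjective (proj f) := fun a => ⟨⟨0, a⟩, rfl⟩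

theorem ker_proj_le_center : (proj f).ker ≤ Subgroup.center (CocycleExtension f) := by
  intro z hz
  have hz : z.base = 1 := hz
  rw [Subgroup.mem_center_iff]
  intro x
  ext
  · simp [hz, val_one_left, val_one_right, add_comm]
  · simp [hz]

theorem eq_one_of_mul_self {z : CocycleExtension f} (hz : z ∈ (proj f).ker) (h : z * z = 1) :
    z = 1 := by
  have hz : z.base = 1 := hz
  have := congrArg fiber h
  simp only [mul_fiber, hz, one_fiber] at this
  ext
  · simp only [one_fiber]; linarith
  · exact hz

/-- A splitting of the extension of a cocycle exhibits the cocycle as a coboundary. -/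
theorem mem_coboundaries_of_splitting (s : G →* CocycleExtension f)
    (hs : ∀ a, (s a).base = a) :
    (f : G × G → ℤ) ∈ groupCohomology.coboundaries₂ (Rep.trivial ℤ G ℤ) := by
  refine ⟨fun a => -(s a).fiber, ?_⟩
  ext ⟨a, b⟩
  have h := congrArg fiber (s.map_mul a b)
  simp only [mul_fiber, hs] at h
  have h' : (f (a, b) : ℤ) = (s (a * b)).fiber - (s a).fiber - (s b).fiber := by
    change val f a b = _
    linarith
  refine Eq.trans ?_ h'.symm
  change -(s b).fiber - -(s (a * b)).fiber + -(s a).fiber = _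
  ring

end CocycleExtension

/-- If every central extension of `G` whose kernel has no 2-torsion splits, then `H²(G; ℤ)`
vanishes. -/
theorem isZero_H2_of_central_extensions_split {G : Type} [Group G]
    (h : ∀ (E : Type) [Group E] (q : E →* G), Function.Surjective q →
      q.ker ≤ Subgroup.center E → (∀ z ∈ q.ker, z * z = 1 → z = 1) →
      ∃ s : G →* E, ∀ a, q (s a) = a) :
    CategoryTheory.Limits.IsZero (groupCohomology (Rep.trivial ℤ G ℤ) 2) := by
  rw [ModuleCat.isZero_iff_subsingleton]
  refine subsingleton_of_forall_eq 0 fun x => ?_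
  induction x using groupCohomology.H2_induction_on with
  | h f =>
    obtain ⟨s, hs⟩ := h (CocycleExtension f) (CocycleExtension.proj f)
      CocycleExtension.proj_surjective CocycleExtension.ker_proj_le_center
      fun z => CocycleExtension.eq_one_of_mul_self
    rw [groupCohomology.H2π_eq_zero_iff]
    exact CocycleExtension.mem_coboundaries_of_splitting s hs

/-- The braid relation between two elements. -/
def Braided {M : Type*} [Mul M] (a b : M) : Prop := a * b * a = b * a * b

theorem Braided.symm {M : Type*} [Mul M] {a b : M} (h : Braided a b) : Braided b a := Eq.symm h

section Braid

variable {M : Type*} [Group M]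

/-- If `a` and `b` are braided, conjugation by `a * b` takes `a` to `b`. -/
theorem Braided.conj_eq {a b : M} (h : Braided a b) : (a * b) * a * (a * b)⁻¹ = b := by
  rw [mul_inv_eq_iff_eq_mul, h, mul_assoc]

/-- The half twist on four strands exchanges the outer generators by conjugation. -/
theorem conj_halfTwist {a b c : M} (hab : Braided a b) (hbc : Braided b c) (hac : Commute a c) :
    (a * b * c * a * b * a) * a * (a * b * c * a * b * a)⁻¹ = c ∧
      (a * b * c * a * b * a) * c * (a * b * c * a * b * a)⁻¹ = a := by
  simp only [mul_inv_eq_iff_eq_mul]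
  unfold Braided at hab hbc
  have hac : a * c = c * a := hac
  constructor
  · calc a * b * c * a * b * a * a
        = a * b * c * (a * b * a) * a := by group
      _ = a * (b * c * b) * a * b * a := by rw [hab]; group
      _ = (a * c) * b * c * a * b * a := by rw [hbc]; group
      _ = c * (a * b * c * a * b * a) := by rw [hac]; group
  · calc a * b * c * a * b * a * c
        = a * b * c * a * b * (a * c) := by group
      _ = a * b * (c * a) * b * c * a := by rw [hac]; group
      _ = a * b * a * (c * b * c) * a := by rw [← hac]; group
      _ = a * (b * a * b) * c * b * a := by rw [← hbc]; group
      _ = a * a * b * (a * c) * b * a := by rw [← hab]; group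
      _ = a * (a * b * c * a * b * a) := by rw [hac]; group

/-- If `b * v * b` commutes with `a` up to a central element `z`, then `z = 1`. -/
theorem eq_one_of_palindrome_commute_mod_center {a b v z : M} (hab : Braided a b)
    (hav : Commute a v) (hz : z ∈ Subgroup.center M)
    (h : (b * v * b) * a = a * (b * v * b) * z) : z = 1 := by
  rw [Subgroup.mem_center_iff] at hz
  unfold Braided at hab
  have hav : a * v = v * a := hav
  obtain ⟨u, hu⟩ : ∃ u, u = a * (b * v * b) * a := ⟨_, rfl⟩
  have hua : u * a = a * u * z := by
    calc u * a = a * ((b * v * b) * a) * a := by rw [hu]; group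
      _ = a * a * (b * v * b) * (z * a) := by rw [h]; group
      _ = a * u * z := by rw [← hz a, hu]; group
  have hub : u * b = b * u := by
    calc u * b = a * b * v * (b * a * b) := by rw [hu]; group
      _ = a * b * (v * a) * b * a := by rw [← hab]; group
      _ = (a * b * a) * v * b * a := by rw [← hav]; group
      _ = b * u := by rw [hab, hu]; group
  have h1 : u * (a * b * a) = a * b * a * u * z * z := by
    calc u * (a * b * a) = (u * a) * b * a := by group
      _ = a * u * (z * (b * a)) := by rw [hua]; group
      _ = a * (u * b) * a * z := by rw [← hz (b * a)]; group
      _ = a * b * (u * a) * z := by rw [hub]; group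
      _ = a * b * a * u * z * z := by rw [hua]; group
  have h2 : u * (b * a * b) = b * a * b * u * z := by
    calc u * (b * a * b) = (u * b) * a * b := by group
      _ = b * (u * a) * b := by rw [hub]; group
      _ = b * a * u * (z * b) := by rw [hua]; group
      _ = b * a * (u * b) * z := by rw [← hz b]; group
      _ = b * a * b * u * z := by rw [hub]; group
  rw [hab, h2] at h1
  exact (mul_eq_left.1 h1.symm)

end Braid

section CentralExtension

open scoped commutatorElement

variable {E G : Type*} [Group E] [Group G] {q : E →* G}

theorem exists_braided_lift (hs : Function.Surjective q) (hc : q.ker ≤ Subgroup.center E)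
    (a : E) (y : G) : ∃ b, q b = y ∧ (Braided (q a) y → Braided a b) := by
  obtain ⟨b, rfl⟩ := hs y
  by_cases h : Braided (q a) (q b)
  · set z := (b * a * b)⁻¹ * (a * b * a) with hz
    have hzk : z ∈ q.ker := by
      rw [MonoidHom.mem_ker, hz]
      simp only [map_mul, map_inv]
      rw [h, inv_mul_cancel]
    have hzc := Subgroup.mem_center_iff.1 (hc hzk)
    refine ⟨b * z, by rw [map_mul, MonoidHom.mem_ker.1 hzk, mul_one], fun _ => ?_⟩
    have h1 : a * b * a = b * a * b * z := by rw [hz]; group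
    unfold Braided
    calc a * (b * z) * a = a * b * (z * a) := by group
      _ = (a * b * a) * z := by rw [← hzc a]; group
      _ = b * (a * b * z) * z := by rw [h1]; group
      _ = b * (z * (a * b)) * z := by rw [hzc (a * b)]
      _ = b * z * a * (b * z) := by group
  · exact ⟨b, rfl, fun h' => absurd h' h⟩

/-- A sequence in the quotient of a central extension lifts to a sequence in which all
consecutive braid relations are preserved. -/
theorem exists_braided_chain_lift (hs : Function.Surjective q)
    (hc : q.ker ≤ Subgroup.center E) (y : ℕ → G) :
    ∃ x : ℕ → E, (∀ n, q (x n) = y n) ∧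
      ∀ n, Braided (y n) (y (n + 1)) → Braided (x n) (x (n + 1)) := by
  choose next h1 h2 using exists_braided_lift hs hc
  obtain ⟨e, he⟩ := hs (y 0)
  let x : ℕ → E := fun n => Nat.rec e (fun k a => next a (y (k + 1))) n
  have hx : ∀ n, q (x n) = y n := by
    intro n
    cases n with
    | zero => exact he
    | succ n => exact h1 _ _
  refine ⟨x, hx, fun n hn => h2 (x n) _ ?_⟩
  rwa [hx]

/-- In a central extension the commutator of two elements depends only on the simultaneous
conjugacy class of their images, provided these commute. -/
theorem commutator_eq_of_conj (hs : Function.Surjective q) (hc : q.ker ≤ Subgroup.center E)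
    {a b a' b' : E} (h : Commute (q a) (q b)) (u : G) (ha : u * q a * u⁻¹ = q a')
    (hb : u * q b * u⁻¹ = q b') : ⁅a', b'⁆ = ⁅a, b⁆ := by
  obtain ⟨e, rfl⟩ := hs u
  have key : ∀ s t : E, q s = q t → ∃ z ∈ Subgroup.center E, s = t * z := by
    intro s t hst
    refine ⟨t⁻¹ * s, hc ?_, by group⟩
    rw [MonoidHom.mem_ker, map_mul, map_inv, hst, inv_mul_cancel]
  obtain ⟨z, hz, rfl⟩ := key a' (e * a * e⁻¹) (by simp [ha])
  obtain ⟨w, hw, rfl⟩ := key b' (e * b * e⁻¹) (by simp [hb])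
  have hab : ⁅a, b⁆ ∈ Subgroup.center E := by
    apply hc
    rw [MonoidHom.mem_ker, map_commutatorElement, commutatorElement_eq_one_iff_commute]
    exact h
  rw [Subgroup.mem_center_iff] at hz hw hab
  have h1 : ⁅e * a * e⁻¹ * z, e * b * e⁻¹ * w⁆ = ⁅e * a * e⁻¹, e * b * e⁻¹⁆ := by
    rw [commutatorElement_def, commutatorElement_def]
    calc _ = e * a * e⁻¹ * (z * (e * b * e⁻¹ * w)) * z⁻¹ * (e * a * e⁻¹)⁻¹ * w⁻¹ *
          (e * b * e⁻¹)⁻¹ := by group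
      _ = e * a * e⁻¹ * (e * b * e⁻¹) * (w * (e * a * e⁻¹)⁻¹) * w⁻¹ * (e * b * e⁻¹)⁻¹ := by
        rw [← hz]; group
      _ = _ := by rw [← hw]; group
  rw [h1]
  calc ⁅e * a * e⁻¹, e * b * e⁻¹⁆ = e * ⁅a, b⁆ * e⁻¹ := by
        simp only [commutatorElement_def]; group
    _ = ⁅a, b⁆ := by rw [hab e, mul_inv_cancel_right]

theorem commute_of_conj (hs : Function.Surjective q) (hc : q.ker ≤ Subgroup.center E)
    {a b a' b' : E} (h : Commute a b) (u : G) (ha : u * q a * u⁻¹ = q a')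
    (hb : u * q b * u⁻¹ = q b') : Commute a' b' := by
  rw [← commutatorElement_eq_one_iff_commute] at h ⊢
  rw [commutator_eq_of_conj hs hc _ u ha hb, h]
  exact (commutatorElement_eq_one_iff_commute.1 h).map q

/-- Elements of a central extension whose images are exchanged by a conjugation and commute
themselves commute, if the kernel has no 2-torsion. -/
theorem commute_of_conj_swap (hs : Function.Surjective q) (hc : q.ker ≤ Subgroup.center E)
    (h2 : ∀ z ∈ q.ker, z * z = 1 → z = 1)
    {a b : E} (h : Commute (q a) (q b)) (u : G) (ha : u * q a * u⁻¹ = q b)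
    (hb : u * q b * u⁻¹ = q a) : Commute a b := by
  rw [← commutatorElement_eq_one_iff_commute]
  refine h2 _ ?_ ?_
  · rw [MonoidHom.mem_ker, map_commutatorElement, commutatorElement_eq_one_iff_commute]
    exact h
  · nth_rewrite 1 [← commutator_eq_of_conj hs hc h u ha hb]
    rw [← commutatorElement_inv, inv_mul_cancel]

/-- If `b` and `b'` are braided and both commute with `a` in the quotient, then `a` commutes
with `b'` in the extension as soon as it commutes with `b`. -/
theorem commute_of_braided (hs : Function.Surjective q) (hc : q.ker ≤ Subgroup.center E)
    {a b b' : E} (h : Commute a b) (hbb : Braided (q b) (q b')) (hab : Commute (q a) (q b')) :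
    Commute a b' := by
  refine commute_of_conj hs hc h (q b * q b') ?_ hbb.conj_eq
  rw [mul_inv_eq_iff_eq_mul]
  exact ((h.map q).mul_right hab).eq.symm

end CentralExtension

namespace Wajnryb

variable {g : ℕ}

/-- The lantern relator. -/
def lantern (g : ℕ) : FreeGroup (Gen g) :=
  c g 0 * b2 g * b1 g * (c g 1 * c g 3 * c g 5 * b3 g)⁻¹

/-- The word that the 3-chain relation identifies with `μ`. -/
def chain (g : ℕ) : FreeGroup (Gen g) := (c g 1 * c g 2 * c g 3) ^ 4 * (c g 0 * b0 g)⁻¹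

section Group

variable {M : Type*} [Group M]

/-- A homomorphism from the free group preserves the braid relations of the Wajnryb generators. -/
def BraidRel (F : FreeGroup (Gen g) →* M) : Prop :=
  ∀ i j, i < 2 * g + 2 → j < 2 * g + 2 → Iw i j → Braided (F (c g i)) (F (c g j))

/-- A homomorphism from the free group preserves the commutation relations of the Wajnryb
generators. -/
def CommRel (F : FreeGroup (Gen g) →* M) : Prop :=
  ∀ i j, i < 2 * g + 2 → j < 2 * g + 2 → ¬ Iw i j → Commute (F (c g i)) (F (c g j))

theorem forall_rels1_iff (F : FreeGroup (Gen g) →* M) :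
    (∀ r ∈ rels1 g, F r = 1) ↔ BraidRel F ∧ CommRel F ∧ F (chain g) = F (mu g) ∧
      (∀ i < 2 * g + 2, Commute (F (c g i)) (F (mu g))) ∧ F (lantern g) = 1 := by
  constructor
  · intro h
    refine ⟨fun i j hi hj hij => ?_, fun i j hi hj hij => ?_, ?_, fun i hi => ?_, ?_⟩
    · have := h _ (.inl (.inl (.inl (.inr ⟨⟨i, hi⟩, ⟨j, hj⟩, hij, rfl⟩))))
      simp only [map_mul, map_inv, mul_inv_eq_one] at this
      exact this
    · have := h _ (.inl (.inl (.inl (.inl ⟨⟨i, hi⟩, ⟨j, hj⟩, hij, rfl⟩))))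
      rw [map_mul, map_inv, mul_inv_eq_one, map_mul, map_mul] at this
      exact this
    · have := h _ (.inl (.inl (.inr rfl)))
      rwa [map_mul, map_inv, mul_inv_eq_one] at this
    · have := h _ (.inl (.inr ⟨⟨i, hi⟩, rfl⟩))
      rw [map_mul, map_inv, mul_inv_eq_one, map_mul, map_mul] at this
      exact this
    · exact h _ (.inr rfl)
  · rintro ⟨hb, hc, hch, hm, hl⟩ r ((((⟨i, j, hij, rfl⟩ | ⟨i, j, hij, rfl⟩) | rfl) | ⟨i, rfl⟩) | rfl)
    · rw [map_mul, map_inv, mul_inv_eq_one, map_mul, map_mul]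
      exact hc i j i.2 j.2 hij
    · simp only [map_mul, map_inv, mul_inv_eq_one]
      exact hb i j i.2 j.2 hij
    · rw [map_mul, map_inv, mul_inv_eq_one]
      exact hch
    · rw [map_mul, map_inv, mul_inv_eq_one, map_mul, map_mul]
      exact hm i i.2
    · exact hl

/-- The homomorphism from the free group with prescribed values on the Wajnryb generators. -/
def homOfSeq (x : ℕ → M) (m : M) : FreeGroup (Gen g) →* M :=
  FreeGroup.lift (Sum.elim (fun i => x i) fun _ => m)

theorem homOfSeq_c (x : ℕ → M) (m : M) {n : ℕ} (hn : n < 2 * g + 2) :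
    homOfSeq x m (c g n) = x n := by
  simp [homOfSeq, c, Nat.mod_eq_of_lt hn]

theorem homOfSeq_mu (x : ℕ → M) (m : M) : homOfSeq x m (mu g) = m := by
  simp [homOfSeq, mu]

theorem hom_ext {F F' : FreeGroup (Gen g) →* M}
    (hc : ∀ n < 2 * g + 2, F (c g n) = F' (c g n)) (hm : F (mu g) = F' (mu g)) : F = F' := by
  ext x
  rcases x with ⟨n, hn⟩ | ⟨⟩
  · have := hc n hn
    simpa [c, Nat.mod_eq_of_lt hn] using this
  · exact hm

/-- A homomorphism multiplied by a homomorphism into the center. -/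
def shift (F : FreeGroup (Gen g) →* M) (D : FreeGroup (Gen g) →* Subgroup.center M) :
    FreeGroup (Gen g) →* M where
  toFun w := F w * D w
  map_one' := by simp
  map_mul' v w := by
    have := Subgroup.mem_center_iff.1 (D v).2 (F w)
    simp only [map_mul, Subgroup.coe_mul]
    calc F v * F w * (D v * D w) = F v * (F w * D v) * D w := by group
      _ = _ := by rw [this]; group

theorem shift_apply (F : FreeGroup (Gen g) →* M) (D : FreeGroup (Gen g) →* Subgroup.center M)
    (w : FreeGroup (Gen g)) : shift F D w = F w * D w := rfl

end Group

section Comm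

variable {A : Type*} [CommGroup A] (D : FreeGroup (Gen g) →* A)

theorem map_conj_comm (u w : FreeGroup (Gen g)) : D (u⁻¹ * w * u) = D w := by
  simp [mul_comm]

theorem map_lantern_comm (hg : 3 ≤ g) {t : A} (h : ∀ n < 2 * g + 2, D (c g n) = t) :
    D (lantern g) = t⁻¹ := by
  have h1 : D (b1 g) = t := by rw [b1, map_conj_comm, h 0 (by omega)]
  have h2 : D (b2 g) = t := by rw [b2, map_conj_comm, h1]
  have h3 : D (b3 g) = t := by rw [b3, map_conj_comm, h 0 (by omega)]
  simp only [lantern, map_mul, map_inv, h1, h2, h3, h 0 (by omega), h 1 (by omega),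
    h 3 (by omega), h 5 (by omega)]
  group

theorem map_chain_comm (hg : 3 ≤ g) {t : A} (h : ∀ n < 2 * g + 2, D (c g n) = t) :
    D (chain g) = t ^ 10 := by
  have h0 : D (b0 g) = t := by rw [b0, map_conj_comm, h 0 (by omega)]
  simp only [chain, map_mul, map_inv, map_pow, h0, h 0 (by omega), h 1 (by omega),
    h 2 (by omega), h 3 (by omega)]
  rw [mul_inv_eq_iff_eq_mul]
  simp only [← pow_succ, ← pow_two, ← pow_mul, ← pow_add]

/-- A homomorphism into an abelian group respecting the braid and lantern relations is trivial on
the Wajnryb generators `c_n`. -/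
theorem map_c_eq_one_of_comm (hg : 3 ≤ g) (hb : BraidRel D) (hl : D (lantern g) = 1) :
    ∀ n < 2 * g + 2, D (c g n) = 1 := by
  have heq : ∀ i j, i < 2 * g + 2 → j < 2 * g + 2 → Iw i j → D (c g i) = D (c g j) := by
    intro i j hi hj hij
    have h := hb i j hi hj hij
    unfold Braided at h
    rw [mul_comm (D (c g i)) (D (c g j)), mul_assoc, mul_assoc, mul_right_inj,
      mul_right_inj] at h
    exact h
  have hpos : ∀ n, n + 1 < 2 * g + 2 → D (c g (n + 1)) = D (c g 1) := by
    intro n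
    induction n with
    | zero => exact fun _ => rfl
    | succ n ih =>
      intro hn
      rw [← ih (by omega)]
      exact heq _ _ hn (by omega) (.inr (.inr ⟨by omega, by omega, .inl rfl⟩))
  have hall : ∀ n < 2 * g + 2, D (c g n) = D (c g 1) := by
    rintro (_ | n) hn
    · rw [heq 0 4 hn (by omega) (.inl ⟨rfl, rfl⟩)]
      exact hpos 3 (by omega)
    · exact hpos n hn
  rw [map_lantern_comm D hg hall, inv_eq_one] at hl
  intro n hn
  rw [hall n hn, hl]

end Comm

section Shift

open scoped IsMulCommutative

variable {M : Type*} [Group M] {F : FreeGroup (Gen g) →* M}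
  {D : FreeGroup (Gen g) →* Subgroup.center M} {t : Subgroup.center M}

theorem BraidRel.shift (hF : BraidRel F) (hD : ∀ n < 2 * g + 2, D (c g n) = t) :
    BraidRel (shift F D) := by
  intro i j hi hj hij
  have h := hF i j hi hj hij
  unfold Braided at h ⊢
  simp only [← map_mul] at h ⊢
  rw [shift_apply, shift_apply, h]
  simp only [map_mul, hD i hi, hD j hj]

theorem CommRel.shift (hF : CommRel F) : CommRel (shift F D) := by
  intro i j hi hj hij
  have h := (hF i j hi hj hij).eq
  change _ * _ = _ * _
  simp only [← map_mul] at h ⊢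
  rw [shift_apply, shift_apply, h, map_mul D, map_mul D, mul_comm (D _)]

end Shift

section Lift

open scoped commutatorElement IsMulCommutative

variable {E G : Type*} [Group E] [Group G] {q : E →* G}

theorem exists_lift_braidRel (hs : Function.Surjective q) (hc : q.ker ≤ Subgroup.center E)
    {φ : FreeGroup (Gen g) →* G} (hg : 3 ≤ g) (hφ : BraidRel φ) :
    ∃ F : FreeGroup (Gen g) →* E, q.comp F = φ ∧ BraidRel F := by
  obtain ⟨x, hx, hxb⟩ := exists_braided_chain_lift hs hc fun n => φ (c g n)
  obtain ⟨a, ha, hab⟩ := exists_braided_lift hs hc (x 4) (φ (c g 0))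
  obtain ⟨m, hm⟩ := hs (φ (mu g))
  rw [hx] at hab
  have h40 := hab (hφ 4 0 (by omega) (by omega) (.inr (.inl ⟨rfl, rfl⟩)))
  have hchain : ∀ n, 1 ≤ n → n + 1 < 2 * g + 2 → Braided (x n) (x (n + 1)) := fun n hn hn' =>
    hxb n (hφ n (n + 1) (by omega) hn' (.inr (.inr ⟨hn, by omega, .inr rfl⟩)))
  let y : ℕ → E := fun n => if n = 0 then a else x n
  have hy0 : y 0 = a := rfl
  have hy : ∀ n, 1 ≤ n → y n = x n := fun n hn => if_neg (by omega)
  refine ⟨homOfSeq y m, hom_ext (fun n hn => ?_) ?_, fun i j hi hj hij => ?_⟩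
  · rw [MonoidHom.comp_apply, homOfSeq_c _ _ hn]
    rcases n with _ | n
    · exact ha
    · rw [hy _ (by omega), hx]
  · rw [MonoidHom.comp_apply, homOfSeq_mu, hm]
  · rw [homOfSeq_c _ _ hi, homOfSeq_c _ _ hj]
    rcases hij with ⟨rfl, rfl⟩ | ⟨rfl, rfl⟩ | ⟨h1, h2, rfl | rfl⟩
    · rw [hy0, hy 4 (by omega)]
      exact h40.symm
    · rw [hy0, hy 4 (by omega)]
      exact h40
    · rw [hy _ h1, hy _ h2]
      exact (hchain j h2 hi).symm
    · rw [hy _ h1, hy _ h2]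
      exact hchain i h1 hj

/-- Lifts of the Wajnryb generators to a central extension without 2-torsion in the kernel
satisfy the commutation relations. -/
theorem commRel_of_comp (hs : Function.Surjective q) (hc : q.ker ≤ Subgroup.center E)
    (h2 : ∀ z ∈ q.ker, z * z = 1 → z = 1) (hg : 3 ≤ g) {F : FreeGroup (Gen g) →* E}
    (hb : BraidRel (q.comp F)) (hcomm : CommRel (q.comp F)) : CommRel F := by
  have h13 : Commute (F (c g 1)) (F (c g 3)) := by
    have hac := hcomm 1 3 (by omega) (by omega) (by unfold Iw; omega)
    obtain ⟨h, h'⟩ := conj_halfTwist (hb 1 2 (by omega) (by omega) (by unfold Iw; omega))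
      (hb 2 3 (by omega) (by omega) (by unfold Iw; omega)) hac
    exact commute_of_conj_swap hs hc h2 hac _ h h'
  have step : ∀ i j k, i < 2 * g + 2 → j < 2 * g + 2 → k < 2 * g + 2 → Iw j k → ¬ Iw i k →
      Commute (F (c g i)) (F (c g j)) → Commute (F (c g i)) (F (c g k)) :=
    fun i j k hi hj hk hjk hik h =>
      commute_of_braided hs hc h (hb j k hj hk hjk) (hcomm i k hi hk hik)
  have h1 : ∀ j, j + 3 < 2 * g + 2 → Commute (F (c g 1)) (F (c g (j + 3))) := by
    intro j
    induction j with
    | zero => exact fun _ => h13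
    | succ j ih =>
      intro hj
      exact step 1 (j + 3) _ (by omega) (by omega) hj (by unfold Iw; omega)
        (by unfold Iw; omega) (ih (by omega))
  have hpos : ∀ i j, i + 3 ≤ j → j < 2 * g + 2 →
      Commute (F (c g (i + 1))) (F (c g j)) := by
    intro i
    induction i with
    | zero =>
      intro j hj hj'
      obtain ⟨k, rfl⟩ := Nat.exists_eq_add_of_le' hj
      exact h1 k hj'
    | succ i ih =>
      intro j hj hj'
      exact (step j (i + 1) _ hj' (by omega) (by omega) (by unfold Iw; omega)
        (by unfold Iw; omega) (ih j (by omega) hj').symm).symm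
  have h01 : Commute (F (c g 0)) (F (c g 1)) :=
    (step 1 4 0 (by omega) (by omega) (by omega) (by unfold Iw; omega) (by unfold Iw; omega)
      (hpos 0 4 (by omega) (by omega))).symm
  have h02 : Commute (F (c g 0)) (F (c g 2)) :=
    (step 2 4 0 (by omega) (by omega) (by omega) (by unfold Iw; omega) (by unfold Iw; omega)
      (hpos 1 4 (by omega) (by omega))).symm
  have h03 : Commute (F (c g 0)) (F (c g 3)) :=
    step 0 2 3 (by omega) (by omega) (by omega) (by unfold Iw; omega) (by unfold Iw; omega) h02
  have h06 : ∀ j, 6 ≤ j → j < 2 * g + 2 → Commute (F (c g 0)) (F (c g j)) := fun j hj hj' =>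
    (step j 4 0 (by omega) (by omega) (by omega) (by unfold Iw; omega) (by unfold Iw; omega)
      (hpos 3 j hj hj').symm).symm
  have h05 : Commute (F (c g 0)) (F (c g 5)) :=
    step 0 6 5 (by omega) (by omega) (by omega) (by unfold Iw; omega) (by unfold Iw; omega)
      (h06 6 le_rfl (by omega))
  have h0 : ∀ j, j < 2 * g + 2 → ¬ Iw 0 j → Commute (F (c g 0)) (F (c g j)) := by
    intro j hj h
    have h4 : j ≠ 4 := fun h4 => h (.inl ⟨rfl, h4⟩)
    rcases (by omega : j = 0 ∨ j = 1 ∨ j = 2 ∨ j = 3 ∨ j = 5 ∨ 6 ≤ j) with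
      rfl | rfl | rfl | rfl | rfl | h6
    exacts [Commute.refl _, h01, h02, h03, h05, h06 j h6 hj]
  intro i j hi hj hij
  rcases i with _ | i
  · exact h0 j hj hij
  rcases j with _ | j
  · exact (h0 _ hi (by unfold Iw at hij ⊢; omega)).symm
  rcases (by unfold Iw at hij; omega : i = j ∨ i + 2 ≤ j ∨ j + 2 ≤ i) with rfl | h | h
  · exact Commute.refl _
  · exact hpos i _ (by omega) hj
  · exact (hpos j _ (by omega) hi).symm

/-- In a central extension, an element that is central in the quotient commutes with all lifts of
the Wajnryb generators satisfying the braid and lantern relations. -/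
theorem commute_of_map_central (hc : q.ker ≤ Subgroup.center E) (hg : 3 ≤ g)
    {F : FreeGroup (Gen g) →* E} (hb : BraidRel F) (hl : F (lantern g) = 1) {m : E}
    (hm : ∀ w, Commute (q m) (q (F w))) : ∀ n < 2 * g + 2, Commute m (F (c g n)) := by
  have hmem : ∀ w, ⁅m, F w⁆ ∈ Subgroup.center E := fun w => hc <| by
    rw [MonoidHom.mem_ker, map_commutatorElement, commutatorElement_eq_one_iff_commute]
    exact hm w
  let δ : FreeGroup (Gen g) →* Subgroup.center E :=
    { toFun := fun w => ⟨⁅m, F w⁆, hmem w⟩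
      map_one' := by simp
      map_mul' := fun v w => by
        have h := Subgroup.mem_center_iff.1 (hmem w) (F v)
        ext
        simp only [map_mul, Subgroup.coe_mul]
        simp only [commutatorElement_def] at h ⊢
        calc m * (F v * F w) * m⁻¹ * (F v * F w)⁻¹
            = m * F v * m⁻¹ * (m * F w * m⁻¹ * (F w)⁻¹) * (F v)⁻¹ := by group
          _ = m * F v * m⁻¹ * ((F v)⁻¹ * (F v * (m * F w * m⁻¹ * (F w)⁻¹))) * (F v)⁻¹ := by group
          _ = _ := by rw [h]; group }
  have hδ : ∀ v w, F v = F w → δ v = δ w := fun v w h => Subtype.ext (by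
    change ⁅m, F v⁆ = ⁅m, F w⁆
    rw [h])
  have hδb : BraidRel δ := by
    intro i j hi hj hij
    have h := hb i j hi hj hij
    unfold Braided at h ⊢
    simp only [← map_mul] at h ⊢
    exact hδ _ _ h
  have hδl : δ (lantern g) = 1 := by
    rw [← map_one δ]
    exact hδ _ _ (by rw [hl, map_one])
  intro n hn
  rw [← commutatorElement_eq_one_iff_commute]
  exact congrArg Subtype.val (map_c_eq_one_of_comm δ hg hδb hδl n hn)

theorem mem_closure_generators (w : FreeGroup (Gen g)) :
    w ∈ Subgroup.closure (insert (mu g) {x | ∃ n < 2 * g + 2, x = c g n}) := by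
  induction w using FreeGroup.induction_on with
  | C1 => exact one_mem _
  | of x =>
    apply Subgroup.subset_closure
    rcases x with ⟨n, hn⟩ | ⟨⟩
    · exact .inr ⟨n, hn, by simp [c, Nat.mod_eq_of_lt hn]⟩
    · exact .inl rfl
  | inv_of x hx => exact inv_mem hx
  | mul x y hx hy => exact mul_mem hx hy

theorem commute_mu_of_generators {M : Type*} [Group M] {φ : FreeGroup (Gen g) →* M}
    (h : ∀ n < 2 * g + 2, Commute (φ (c g n)) (φ (mu g))) (w : FreeGroup (Gen g)) :
    Commute (φ (mu g)) (φ w) := by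
  induction mem_closure_generators w using Subgroup.closure_induction with
  | mem x hx =>
    rcases hx with rfl | ⟨n, hn, rfl⟩
    · exact Commute.refl _
    · exact (h n hn).symm
  | one => simp
  | mul x y _ _ hx hy => rw [map_mul]; exact hx.mul_right hy
  | inv x _ hx => rw [map_inv]; exact hx.inv_right

/-- A homomorphism killing the relators of `G_{g,1}` lifts to any central extension whose kernel
has no 2-torsion, still killing these relators. -/
theorem exists_lift_rels1 (hs : Function.Surjective q) (hc : q.ker ≤ Subgroup.center E)
    (h2 : ∀ z ∈ q.ker, z * z = 1 → z = 1) (hg : 3 ≤ g) {φ : FreeGroup (Gen g) →* G}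
    (hφ : ∀ r ∈ rels1 g, φ r = 1) :
    ∃ F : FreeGroup (Gen g) →* E, q.comp F = φ ∧ ∀ r ∈ rels1 g, F r = 1 := by
  obtain ⟨hφb, hφc, hφch, hφm, hφl⟩ := (forall_rels1_iff φ).1 hφ
  obtain ⟨F, rfl, hFb⟩ := exists_lift_braidRel hs hc hg hφb
  have hFc := commRel_of_comp hs hc h2 hg hφb hφc
  have hzl : F (lantern g) ∈ q.ker := hφl
  have hzm : (F (chain g))⁻¹ * F (mu g) ∈ q.ker := by
    rw [MonoidHom.mem_ker, map_mul, map_inv]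
    exact inv_mul_eq_one.2 hφch
  let t : Subgroup.center E := ⟨_, hc hzl⟩
  let z : Subgroup.center E := ⟨_, hc hzm⟩
  let D : FreeGroup (Gen g) →* Subgroup.center E := homOfSeq (fun _ => t) (z⁻¹ * t ^ 10)
  have hDc : ∀ n < 2 * g + 2, D (c g n) = t := fun n hn => homOfSeq_c _ _ hn
  have hDm : D (mu g) = z⁻¹ * t ^ 10 := homOfSeq_mu _ _
  have hqt : q t = 1 := hzl
  have hqz : q z = 1 := hzm
  have hq : q.comp (shift F D) = q.comp F := by
    refine hom_ext (fun n hn => ?_) ?_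
    · simp [shift_apply, hDc n hn, hqt]
    · simp [shift_apply, hDm, hqt, hqz]
  have hb' : BraidRel (shift F D) := hFb.shift hDc
  have hl' : shift F D (lantern g) = 1 := by
    rw [shift_apply, map_lantern_comm D hg hDc]
    exact mul_inv_cancel (F (lantern g))
  refine ⟨shift F D, hq, (forall_rels1_iff _).2 ⟨hb', hFc.shift, ?_, fun n hn => ?_, hl'⟩⟩
  · rw [shift_apply, shift_apply, map_chain_comm D hg hDc, hDm, Subgroup.coe_mul, ← mul_assoc]
    congr 1
    change _ = F (mu g) * ((F (chain g))⁻¹ * F (mu g))⁻¹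
    group
  · refine (commute_of_map_central hc hg hb' hl' (fun w => ?_) n hn).symm
    exact commute_mu_of_generators (φ := q.comp (shift F D)) (by rw [hq]; exact hφm) w

/-- The word of the closed-surface relation commutes with `c_{2g+1}` in a central extension as
soon as it does so in the quotient. -/
theorem dword_commute_of_map (hc : q.ker ≤ Subgroup.center E) (hg : 3 ≤ g)
    {F : FreeGroup (Gen g) →* E} (hb : BraidRel F) (hcomm : CommRel F)
    (h : Commute (q (F (dword g))) (q (F (c g (2 * g + 1))))) :
    Commute (F (dword g)) (F (c g (2 * g + 1))) := by
  set v : FreeGroup (Gen g) := ((List.range' 1 (2 * g - 1)).reverse.map (c g)).prod *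
    ((List.range' 1 (2 * g - 1)).map (c g)).prod with hv
  have hd : dword g = c g (2 * g) * v * c g (2 * g) := by
    have hr : List.range' 1 (2 * g) = List.range' 1 (2 * g - 1) ++ [2 * g] := by
      obtain ⟨k, hk⟩ : ∃ k, 2 * g = k + 1 := ⟨2 * g - 1, by omega⟩
      rw [hk, List.range'_1_concat, Nat.add_sub_cancel, add_comm]
    rw [dword, hr, hv]
    simp [mul_assoc]
  have hav : Commute (F (c g (2 * g + 1))) (F v) := by
    have hk : ∀ k ∈ List.range' 1 (2 * g - 1), Commute (F (c g (2 * g + 1))) (F (c g k)) := by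
      intro k hk
      rw [List.mem_range'_1] at hk
      exact hcomm _ _ (by omega) (by omega) (by unfold Iw; omega)
    rw [hv, map_mul, map_list_prod, map_list_prod]
    refine (Commute.list_prod_right _ _ ?_).mul_right (Commute.list_prod_right _ _ ?_) <;>
    · intro x hx
      simp only [List.map_map, List.mem_map, List.mem_reverse] at hx
      obtain ⟨k, hkm, rfl⟩ := hx
      exact hk k hkm
  set a := F (c g (2 * g + 1))
  set z := (a * F (dword g))⁻¹ * (F (dword g) * a) with hz
  have hzc : z ∈ Subgroup.center E := hc <| by
    rw [MonoidHom.mem_ker, hz, map_mul, map_inv, map_mul, map_mul, h.eq, inv_mul_cancel]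
  have hz1 : z = 1 := by
    refine eq_one_of_palindrome_commute_mod_center (b := F (c g (2 * g)))
      (hb _ _ (by omega) (by omega) (by unfold Iw; omega)) hav hzc ?_
    rw [← map_mul, ← map_mul, ← hd, hz, mul_inv_cancel_left]
  rw [hz, inv_mul_eq_one] at hz1
  exact hz1.symm

end Lift

end Wajnryb

/-- If a homomorphism `F` kills the relators and lifts the quotient map of a presented group
along `q`, then `q` splits. -/
theorem PresentedGroup.exists_splitting {α E : Type*} [Group E] {R : Set (FreeGroup α)}
    {q : E →* PresentedGroup R} {F : FreeGroup α →* E} (hq : q.comp F = PresentedGroup.mk R)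
    (hF : ∀ r ∈ R, F r = 1) : ∃ s : PresentedGroup R →* E, ∀ a, q (s a) = a := by
  have hlift : FreeGroup.lift (fun a => F (FreeGroup.of a)) = F :=
    FreeGroup.ext_hom _ _ fun a => by simp
  refine ⟨PresentedGroup.toGroup (f := fun a => F (FreeGroup.of a)) (by rwa [hlift]), ?_⟩
  refine DFunLike.congr_fun (f := q.comp _) (g := MonoidHom.id _) (PresentedGroup.ext fun x => ?_)
  rw [MonoidHom.comp_apply, PresentedGroup.toGroup.of]
  exact DFunLike.congr_fun hq (FreeGroup.of x)

open Wajnryb in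
/-- For `g ≥ 3` and `r ∈ {0,1}`, the second group cohomology of the
centrally extended Wajnryb group `G_{g,r}` with coefficients in the trivial module `ℤ`
vanishes. -/
theorem H2_Ggr_trivial (g : ℕ) (hg : 3 ≤ g) :
    CategoryTheory.Limits.IsZero (groupCohomology (Rep.trivial ℤ (Gg1 g) ℤ) 2) ∧
    CategoryTheory.Limits.IsZero (groupCohomology (Rep.trivial ℤ (Gg0 g) ℤ) 2) := by
  constructor
  · refine isZero_H2_of_central_extensions_split fun E _ q hs hc h2 => ?_
    obtain ⟨F, hF, hr⟩ := exists_lift_rels1 hs hc h2 hg (φ := PresentedGroup.mk (rels1 g))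
      fun r hr => PresentedGroup.one_of_mem hr
    exact PresentedGroup.exists_splitting hF hr
  · refine isZero_H2_of_central_extensions_split fun E _ q hs hc h2 => ?_
    obtain ⟨F, hF, hr⟩ := exists_lift_rels1 hs hc h2 hg (φ := PresentedGroup.mk (rels0 g))
      fun r hr => PresentedGroup.one_of_mem (.inl hr)
    refine PresentedGroup.exists_splitting hF ?_
    rintro r (h | rfl)
    · exact hr r h
    · obtain ⟨hb, hcomm, -⟩ := (forall_rels1_iff F).1 hr
      have hd := PresentedGroup.one_of_mem (rels := rels0 g) (.inr rfl)
      rw [map_mul, map_inv, mul_inv_eq_one, map_mul, map_mul] at hd ⊢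
      refine dword_commute_of_map hc hg hb hcomm ?_
      simp only [← MonoidHom.comp_apply, hF]
      exact hd
end
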